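/- Assume additionally a_i' > 0, a_j' > 0, φ(x_i,x_j) > 0, φ'_i > 0, φ'_j > 0, q_ij + q_i' > 0 and q_ij + q_j' > 0. Then there exist real numbers α ∈ [−x_i, 1−x_i] and β ∈ [−x_j, 1−x_j], with at least one of them attaining an endpoint of its interval (i.e., α ∈ {−x_i, 1−x_i} or β ∈ {−x_j, 1−x_j}), such that φ(x_i+α, x_j+β) ≥ φ(x_i, x_j) and ψ(x_i+α, x_j+β) ≤ ψ(x_i, x_j). -/

import Mathlib

/-- Moving from `(x, y)` in the direction `(u, -v)`, with `u, v > 0`, one stays in the region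
`x ≤ 1`, `0 ≤ y` up to a first time at which its boundary is reached. -/
lemma exists_step_to_boundary {x y u v : ℝ} (hx : x < 1) (hy : 0 < y) (hu : 0 < u) (hv : 0 < v) :
    ∃ t : ℝ, 0 < t ∧ t * u ≤ 1 - x ∧ t * v ≤ y ∧ (t * u = 1 - x ∨ t * v = y) := by
  have hx' : 0 < 1 - x := sub_pos.2 hx
  rcases le_total ((1 - x) / u) (y / v) with h | h
  · exact ⟨(1 - x) / u, by positivity, (div_mul_cancel₀ _ hu.ne').le, (le_div_iff₀ hv).1 h,
      Or.inl (div_mul_cancel₀ _ hu.ne')⟩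
  · exact ⟨y / v, by positivity, (le_div_iff₀ hu).1 h, (div_mul_cancel₀ _ hv.ne').le,
      Or.inr (div_mul_cancel₀ _ hv.ne')⟩

/-- Pipage rounding step: two fractional variables can be rounded so that at least
one of them hits an endpoint, without decreasing φ or increasing ψ. -/
theorem stmt_3 (a_ij a_i' a_j' q_ij q_i' q_j' x_i x_j : ℝ)
    (haij : a_ij ≤ 0) (hqij : 0 ≤ q_ij) (hqi : 0 ≤ q_i') (hqj : 0 ≤ q_j')
    (hxi0 : 0 < x_i) (hxi1 : x_i < 1) (hxj0 : 0 < x_j) (hxj1 : x_j < 1)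
    (hai : 0 < a_i') (haj : 0 < a_j')
    (hphi : 0 < a_ij * x_i * x_j + a_i' * x_i + a_j' * x_j)
    (hphii : 0 < a_ij * x_j + a_i') (hphij : 0 < a_ij * x_i + a_j')
    (hq1 : 0 < q_ij + q_i') (hq2 : 0 < q_ij + q_j') :
    ∃ α β : ℝ, α ∈ Set.Icc (-x_i) (1 - x_i) ∧ β ∈ Set.Icc (-x_j) (1 - x_j) ∧
      (α = -x_i ∨ α = 1 - x_i ∨ β = -x_j ∨ β = 1 - x_j) ∧
      a_ij * (x_i + α) * (x_j + β) + a_i' * (x_i + α) + a_j' * (x_j + β) ≥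
        a_ij * x_i * x_j + a_i' * x_i + a_j' * x_j ∧
      q_ij * (x_i + α) * (x_j + β) + q_i' * (x_i + α) + q_j' * (x_j + β) ≤
        q_ij * x_i * x_j + q_i' * x_i + q_j' * x_j := by
  set u := a_ij * x_i + a_j' with hu
  set v := a_ij * x_j + a_i' with hv
  rcases le_total ((q_ij * x_j + q_i') * u) ((q_ij * x_i + q_j') * v) with h | h
  · obtain ⟨t, ht, h1, h2, h3⟩ := exists_step_to_boundary hxi1 hxj0 hphij hphii
    have hpos : 0 ≤ (t * u) * (t * v) := by positivity
    have hq := mul_nonneg hqij hpos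
    have ha := mul_nonneg (neg_nonneg.2 haij) hpos
    have hψ := mul_le_mul_of_nonneg_left h ht.le
    have hα : 0 < t * u := by positivity
    have hβ : 0 < t * v := by positivity
    refine ⟨t * u, -(t * v), ⟨by linarith, h1⟩, ⟨by linarith, by linarith⟩, ?_, ?_, ?_⟩
    · rcases h3 with h3 | h3 <;> simp [h3]
    · have hφ : a_ij * x_j * (t * u) + a_i' * (t * u) = (a_ij * x_i + a_j') * (t * v) := by
        rw [← hu, hv]; ring
      linarith
    · linarith
  · obtain ⟨t, ht, h1, h2, h3⟩ := exists_step_to_boundary hxj1 hxi0 hphii hphij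
    have hpos : 0 ≤ (t * u) * (t * v) := by positivity
    have hq := mul_nonneg hqij hpos
    have ha := mul_nonneg (neg_nonneg.2 haij) hpos
    have hψ := mul_le_mul_of_nonneg_left h ht.le
    have hα : 0 < t * u := by positivity
    have hβ : 0 < t * v := by positivity
    refine ⟨-(t * u), t * v, ⟨by linarith, by linarith⟩, ⟨by linarith, h1⟩, ?_, ?_, ?_⟩
    · rcases h3 with h3 | h3 <;> simp [h3]
    · have hφ : a_ij * x_j * (t * u) + a_i' * (t * u) = (a_ij * x_i + a_j') * (t * v) := by
        rw [← hu, hv]; ring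
      linarith
    · linarith
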